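/- arXiv:1711.02277 — 7 statements merged into one kernel-verified Lean document; each statement's English description precedes it below -/
import Mathlib

section
/- Let A be a symmetric positive definite real n×n matrix written as A = D + L + U, where D is the diagonal part of A, L is the strictly lower triangular part, and U is the strictly upper triangular part. Let ω ∈ (0,2) and set h = 2ω/(2−ω). Then the matrices (1 + h/2)·D + h·L and D + ω·L are invertible, and the iteration matrix and vector of the Itoh–Abe discrete gradient scheme coincide with those of the SOR method: ((1 + h/2)·D + h·L)⁻¹ * ((1 − h/2)·D − h·U) = (D + ω·L)⁻¹ * ((1 − ω)·D − ω·U), and for every b ∈ ℝⁿ, h · ((1 + h/2)·D + h·L)⁻¹ *ᵥ b = ω · (D + ω·L)⁻¹ *ᵥ b. -/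
open Matrix

/-- The diagonal part of a matrix with nonzero diagonal plus any multiple of its strictly lower
triangular part is invertible. -/
theorem isUnit_diagonal_add_smul_strictLower {ι K : Type*} [Fintype ι] [LinearOrder ι] [Field K]
    (A : Matrix ι ι K) (hA : ∀ i, A i i ≠ 0) (ω : K) :
    IsUnit ((Matrix.diagonal fun i => A i i) +
      ω • Matrix.of fun i j => if j < i then A i j else 0) := by
  rw [Matrix.isUnit_iff_isUnit_det, Matrix.det_of_isLowerTriangular, isUnit_iff_ne_zero,
    Finset.prod_ne_zero_iff]
  · intro i _
    simpa using hA i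
  · intro i j hij
    have hlt : i < j := hij
    simp [hlt.ne, hlt.not_gt]

/-- Equivalence between the Itoh–Abe discrete gradient scheme and the SOR method:
for a symmetric positive definite matrix `A = D + L + U` and `ω ∈ (0,2)`, with
`h = 2ω/(2-ω)`, the matrices `(1+h/2)D + hL` and `D + ωL` are invertible,
the iteration matrices coincide, and the iteration vectors coincide for every `b`. -/
theorem sor_discrete_gradient_equivalence {n : ℕ}
    (A : Matrix (Fin n) (Fin n) ℝ) (hA : A.PosDef) (hAsymm : A = Aᵀ)
    (D L U : Matrix (Fin n) (Fin n) ℝ)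
    (hD : D = Matrix.diagonal fun i => A i i)
    (hL : L = Matrix.of fun i j => if j < i then A i j else 0)
    (hU : U = Matrix.of fun i j => if i < j then A i j else 0)
    (ω : ℝ) (hω : ω ∈ Set.Ioo (0 : ℝ) 2)
    (h : ℝ) (hh : h = 2 * ω / (2 - ω)) :
    IsUnit ((1 + h / 2) • D + h • L) ∧ IsUnit (D + ω • L) ∧
    ((1 + h / 2) • D + h • L)⁻¹ * ((1 - h / 2) • D - h • U)
      = (D + ω • L)⁻¹ * ((1 - ω) • D - ω • U) ∧
    ∀ b : Fin n → ℝ,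
      h • (((1 + h / 2) • D + h • L)⁻¹).mulVec b
        = ω • ((D + ω • L)⁻¹).mulVec b := by
  obtain ⟨hω0, hω2⟩ := hω
  have hne : 2 - ω ≠ 0 := by linarith
  obtain ⟨c, hc⟩ : ∃ c : ℝ, c = 2 / (2 - ω) := ⟨_, rfl⟩
  have hc0 : c ≠ 0 := by rw [hc]; exact div_ne_zero two_ne_zero hne
  have h_eq : h = c * ω := by rw [hh, hc]; ring
  have h_add : 1 + h / 2 = c := by rw [hh, hc]; field_simp; ring
  have h_sub : 1 - h / 2 = c * (1 - ω) := by rw [hh, hc]; field_simp; ring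
  have hM : IsUnit (D + ω • L) := by
    rw [hD, hL]
    exact isUnit_diagonal_add_smul_strictLower A (fun i => hA.diag_pos.ne') ω
  have hP : (1 + h / 2) • D + h • L = c • (D + ω • L) := by
    rw [h_add, h_eq, smul_add, smul_smul]
  have hQ : (1 - h / 2) • D - h • U = c • ((1 - ω) • D - ω • U) := by
    rw [h_sub, h_eq, smul_sub, smul_smul, smul_smul]
  have hinv : (c • (D + ω • L))⁻¹ = c⁻¹ • (D + ω • L)⁻¹ :=
    Matrix.inv_smul' (D + ω • L) (Units.mk0 c hc0)
      ((Matrix.isUnit_iff_isUnit_det _).mp hM)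
  rw [hP, hQ, hinv]
  refine ⟨hM.smul (Units.mk0 c hc0), hM, ?_, fun b => ?_⟩
  · rw [Matrix.smul_mul, Matrix.mul_smul, smul_smul, inv_mul_cancel₀ hc0, one_smul]
  · rw [Matrix.smul_mulVec, smul_smul, h_eq, mul_right_comm, mul_inv_cancel₀ hc0, one_mul]
end

section
/- Let D, L, U be real n×n matrices (a block splitting A = D + L + U), let ω be a real number with ω ≠ 0 and ω ≠ 2, set h = 2ω/(2−ω), and assume that D + ω·L is invertible. Then (1 + h/2)·D + h·L is invertible, and ((1 + h/2)·D + h·L)⁻¹ * ((1 − h/2)·D − h·U) = (D + ω·L)⁻¹ * ((1 − ω)·D − ω·U), and for every b ∈ ℝⁿ, h · ((1 + h/2)·D + h·L)⁻¹ *ᵥ b = ω · (D + ω·L)⁻¹ *ᵥ b. (In particular, with D, L, U the block diagonal, strictly block lower, and strictly block upper parts of A, the blockwise Itoh–Abe discrete gradient scheme is equivalent to the block SOR method.) -/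
open Matrix

/-- Equivalence between the blockwise Itoh–Abe discrete gradient scheme and the
block SOR method: for any splitting `A = D + L + U` with `D + ωL` invertible,
`ω ≠ 0`, `ω ≠ 2` and `h = 2ω/(2-ω)`, the matrix `(1+h/2)D + hL` is invertible,
the iteration matrices coincide, and the iteration vectors coincide for every `b`. -/
theorem block_sor_discrete_gradient_equivalence {n : ℕ}
    (D L U : Matrix (Fin n) (Fin n) ℝ)
    (ω : ℝ) (hω0 : ω ≠ 0) (hω2 : ω ≠ 2)
    (h : ℝ) (hh : h = 2 * ω / (2 - ω))
    (hinv : IsUnit (D + ω • L)) :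
    IsUnit ((1 + h / 2) • D + h • L) ∧
    ((1 + h / 2) • D + h • L)⁻¹ * ((1 - h / 2) • D - h • U)
      = (D + ω • L)⁻¹ * ((1 - ω) • D - ω • U) ∧
    ∀ b : Fin n → ℝ,
      h • (((1 + h / 2) • D + h • L)⁻¹).mulVec b
        = ω • ((D + ω • L)⁻¹).mulVec b := by
  have hω : 2 - ω ≠ 0 := sub_ne_zero.mpr hω2.symm
  obtain ⟨c, hc⟩ : ∃ c : ℝ, c = 2 / (2 - ω) := ⟨_, rfl⟩
  have hc0 : c ≠ 0 := hc ▸ div_ne_zero two_ne_zero hω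
  have hhc : h = c * ω := by rw [hh, hc]; ring
  have hadd : 1 + h / 2 = c := by rw [hh, hc]; field_simp; ring
  have hsub : 1 - h / 2 = c * (1 - ω) := by rw [hh, hc]; field_simp; ring
  have hM : (1 + h / 2) • D + h • L = c • (D + ω • L) := by
    rw [hadd, hhc, smul_add, smul_smul]
  have hN : (1 - h / 2) • D - h • U = c • ((1 - ω) • D - ω • U) := by
    rw [hsub, hhc, smul_sub, smul_smul, smul_smul]
  have hMinv : (c • (D + ω • L))⁻¹ = c⁻¹ • (D + ω • L)⁻¹ :=
    inv_smul' (A := D + ω • L) (Units.mk0 c hc0) ((isUnit_iff_isUnit_det _).mp hinv)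
  rw [hM, hN, hMinv]
  refine ⟨hinv.smul (Units.mk0 c hc0), ?_, fun b => ?_⟩
  · rw [smul_mul_smul_comm, inv_mul_cancel₀ hc0, one_smul]
  · rw [smul_mulVec, smul_smul, hhc, mul_right_comm, mul_inv_cancel₀ hc0, one_mul]
end

section
/- Let p be a positive natural number, let m : Fin p → ℕ, and let f : (Π i, EuclideanSpace ℝ (Fin (m i))) → ℝ be continuously differentiable. For x, y in the domain define the i-th block of the blockwise Itoh–Abe discrete gradient by g_i(x,y) = ∫₀¹ ∇_i f(x₁,…,x_{i−1}, ξ·x_i + (1−ξ)·y_i, y_{i+1},…,y_p) dξ, where ∇_i denotes the gradient with respect to the i-th block. Then g is a discrete gradient of f: (i) Σ_{i} ⟪g_i(x,y), x_i − y_i⟫ = f(x) − f(y) for all x, y, and (ii) g_i(x,x) = ∇_i f(x) for all x and all i. -/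
open RealInnerProductSpace

theorem ContDiff.continuous_gradient {E : Type*} [NormedAddCommGroup E] [InnerProductSpace ℝ E]
    [CompleteSpace E] {h : E → ℝ} (hh : ContDiff ℝ 1 h) : Continuous (gradient h) :=
  (InnerProductSpace.toDual ℝ E).symm.continuous.comp (hh.continuous_fderiv one_ne_zero)

/-- The mean-value discrete gradient satisfies the discrete chain rule. -/
theorem inner_integral_gradient_segment {E : Type*} [NormedAddCommGroup E]
    [InnerProductSpace ℝ E] [CompleteSpace E] {h : E → ℝ} (hh : ContDiff ℝ 1 h) (a b : E) :
    ⟪∫ ξ in (0 : ℝ)..1, gradient h (ξ • a + (1 - ξ) • b), a - b⟫ = h a - h b := by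
  have hc : Continuous fun ξ : ℝ => gradient h (ξ • a + (1 - ξ) • b) :=
    hh.continuous_gradient.comp (by fun_prop)
  have hd : ∀ ξ : ℝ, HasDerivAt (fun ξ : ℝ => h (ξ • a + (1 - ξ) • b))
      ⟪a - b, gradient h (ξ • a + (1 - ξ) • b)⟫ ξ := by
    intro ξ
    have hseg : HasDerivAt (fun ξ : ℝ => ξ • a + (1 - ξ) • b) (a - b) ξ := by
      simpa [sub_eq_add_neg] using ((hasDerivAt_id ξ).smul_const a).fun_add
        (((hasDerivAt_id ξ).const_sub 1).smul_const b)
    have hg := (hh.differentiable one_ne_zero (ξ • a + (1 - ξ) • b)).hasGradientAt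
    rw [real_inner_comm]
    exact hg.hasFDerivAt.comp_hasDerivAt ξ hseg
  have hi : ∫ ξ in (0 : ℝ)..1, ⟪a - b, gradient h (ξ • a + (1 - ξ) • b)⟫ = h a - h b := by
    rw [intervalIntegral.integral_eq_sub_of_hasDerivAt (fun ξ _ => hd ξ)
      ((continuous_const.inner hc).intervalIntegrable 0 1)]
    simp
  rw [real_inner_comm, ← hi]
  exact ((innerSL ℝ (a - b)).intervalIntegral_comp_comm (hc.intervalIntegrable 0 1)).symm

/-- The blockwise Itoh–Abe discrete gradient
`g_i(x,y) = ∫₀¹ ∇_i f(x₁,…,x_{i-1}, ξx_i + (1-ξ)y_i, y_{i+1},…,y_p) dξ`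
of a `C¹` function `f` on a product of Euclidean blocks is a discrete gradient:
it satisfies the (blockwise) discrete chain rule and the consistency condition
`g_i(x,x) = ∇_i f(x)`. -/
theorem blockwise_itoh_abe_discrete_gradient (p : ℕ) (hp : 0 < p)
    (m : Fin p → ℕ)
    (f : (∀ i, EuclideanSpace ℝ (Fin (m i))) → ℝ) (hf : ContDiff ℝ 1 f)
    (g : (∀ i, EuclideanSpace ℝ (Fin (m i))) → (∀ i, EuclideanSpace ℝ (Fin (m i))) →
      ∀ i, EuclideanSpace ℝ (Fin (m i)))
    (hg : ∀ (x y : ∀ i, EuclideanSpace ℝ (Fin (m i))) (i : Fin p),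
      g x y i = ∫ ξ in (0 : ℝ)..1,
        gradient (fun z => f (Function.update (fun j => if j < i then x j else y j) i z))
          (ξ • x i + (1 - ξ) • y i)) :
    (∀ x y : ∀ i, EuclideanSpace ℝ (Fin (m i)),
      ∑ i : Fin p, ⟪g x y i, x i - y i⟫ = f x - f y) ∧
    (∀ (x : ∀ i, EuclideanSpace ℝ (Fin (m i))) (i : Fin p),
      g x x i = gradient (fun z => f (Function.update x i z)) (x i)) := by
  refine ⟨fun x y => ?_, fun x i => ?_⟩
  · have hblock : ∀ i : Fin p, ⟪g x y i, x i - y i⟫ =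
        f (fun j => if j.val < i.val + 1 then x j else y j) -
          f (fun j => if j.val < i.val then x j else y j) := by
      intro i
      rw [hg, inner_integral_gradient_segment
        (h := fun z => f (Function.update (fun j => if j < i then x j else y j) i z))
        (hf.comp (contDiff_update 1 _ i))]
      congr 2 <;> funext j <;> rcases eq_or_ne j i with rfl | hj
      · simp
      · have hlt : j.val < i.val + 1 ↔ j < i := by
          have := Fin.val_ne_of_ne hj
          rw [Fin.lt_def]
          omega
        simp [Function.update_of_ne hj, hlt]
      · simp
      · simp [Function.update_of_ne hj]
    simp_rw [hblock]
    rw [Fin.sum_univ_eq_sum_range (fun k =>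
      f (fun j => if j.val < k + 1 then x j else y j) -
        f (fun j => if j.val < k then x j else y j)) p,
      Finset.sum_range_sub (fun k => f (fun j => if j.val < k then x j else y j))]
    simp
  · rw [hg]
    simp [← add_smul]
end

section
/- Let f : ℝⁿ → ℝ be differentiable and let ∇_d f : ℝⁿ × ℝⁿ → ℝⁿ satisfy the discrete chain rule f(x) − f(y) = ∇_d f(x,y)ᵀ(x − y) for all x, y. Let P be a symmetric positive definite real n×n matrix and let h > 0. If x' ∈ ℝⁿ satisfies x' − x = −h · P *ᵥ ∇_d f(x', x), then f(x') ≤ f(x); moreover, if ∇_d f(x', x) ≠ 0, then f(x') < f(x). -/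
open Matrix

/-- Discrete energy dissipation of the discrete gradient scheme: if `∇_d f`
satisfies the discrete chain rule, `P` is symmetric positive definite, `h > 0`
and `x' - x = -h P ∇_d f(x', x)`, then `f(x') ≤ f(x)`, with strict inequality
when `∇_d f(x', x) ≠ 0`. -/
theorem discrete_gradient_scheme_dissipation {n : ℕ}
    (f : (Fin n → ℝ) → ℝ) (hf : Differentiable ℝ f)
    (g : (Fin n → ℝ) → (Fin n → ℝ) → (Fin n → ℝ))
    (hg : ∀ x y, f x - f y = g x y ⬝ᵥ (x - y))
    (P : Matrix (Fin n) (Fin n) ℝ) (hP : P.PosDef)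
    (h : ℝ) (hh : 0 < h)
    (x x' : Fin n → ℝ)
    (hstep : x' - x = -(h • P.mulVec (g x' x))) :
    f x' ≤ f x ∧ (g x' x ≠ 0 → f x' < f x) := by
  have hdiff : f x' - f x = -(h * (g x' x ⬝ᵥ P *ᵥ g x' x)) := by
    rw [hg, hstep, dotProduct_neg, dotProduct_smul, smul_eq_mul]
  have hnonneg : 0 ≤ g x' x ⬝ᵥ P *ᵥ g x' x := by
    simpa using hP.posSemidef.dotProduct_mulVec_nonneg (g x' x)
  refine ⟨by linarith [mul_nonneg hh.le hnonneg], fun hne => ?_⟩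
  have hpos : 0 < g x' x ⬝ᵥ P *ᵥ g x' x := by
    simpa using hP.dotProduct_mulVec_pos hne
  linarith [mul_pos hh hpos]
end

section
/- Let A be a symmetric real n×n matrix, b ∈ ℝⁿ, and f(x) = (1/2) xᵀ A x − xᵀ b. Let x, y ∈ ℝⁿ with x_i ≠ y_i for every i. Then the i-th component of the Itoh–Abe discrete gradient of f equals Σ_{j<i} a_{ij} x_j + a_{ii} (x_i + y_i)/2 + Σ_{j>i} a_{ij} y_j − b_i, i.e. (f(x₁,…,x_i,y_{i+1},…,y_n) − f(x₁,…,x_{i−1},y_i,…,y_n))/(x_i − y_i) = Σ_{j<i} a_{ij} x_j + a_{ii}(x_i + y_i)/2 + Σ_{j>i} a_{ij} y_j − b_i for each i. -/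
open Matrix Finset

/-- Increment of a quadratic energy with symmetric matrix along a coordinate direction. -/
theorem quadratic_energy_add_single_sub {ι : Type*} [Fintype ι] [DecidableEq ι]
    {A : Matrix ι ι ℝ} (hA : A.IsSymm) (b w : ι → ℝ) (i : ι) (t : ℝ) :
    ((1 / 2) * ((w + Pi.single i t) ⬝ᵥ A.mulVec (w + Pi.single i t))
        - (w + Pi.single i t) ⬝ᵥ b) - ((1 / 2) * (w ⬝ᵥ A.mulVec w) - w ⬝ᵥ b)
      = t * (A.mulVec w i + A i i * t / 2 - b i) := by
  have hcross : w ⬝ᵥ A.mulVec (Pi.single i t) = t * A.mulVec w i := by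
    rw [dotProduct_mulVec, ← mulVec_transpose, hA.eq, dotProduct_single, mul_comm]
  have hdiag : A.mulVec (Pi.single i t) i = A i i * t := by
    simp [mulVec, dotProduct_single]
  rw [mulVec_add, add_dotProduct, dotProduct_add, dotProduct_add, hcross, add_dotProduct,
    single_dotProduct, single_dotProduct, single_dotProduct, hdiag]
  ring

/-- A sum over a finite linear order splits into the parts below, at and above an element. -/
theorem sum_eq_sum_lt_add_add_sum_gt {ι M : Type*} [Fintype ι] [LinearOrder ι]
    [AddCommMonoid M] (g : ι → M) (i : ι) :
    ∑ j, g j = (∑ j ∈ univ.filter (fun j => j < i), g j) + g i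
      + ∑ j ∈ univ.filter (fun j => i < j), g j := by
  have hle : univ.filter (fun j => ¬ i < j) = insert i (univ.filter (fun j => j < i)) := by
    ext j
    simp [le_iff_eq_or_lt]
  rw [← sum_filter_not_add_sum_filter univ (fun j => i < j) g, hle, sum_insert (by simp),
    add_comm (g i)]

/-- For the quadratic energy `f(x) = ½ xᵀAx - xᵀb` with `A` symmetric, the
`i`-th component of the Itoh–Abe discrete gradient equals
`∑_{j<i} a_ij x_j + a_ii (x_i+y_i)/2 + ∑_{j>i} a_ij y_j - b_i`. -/
theorem itoh_abe_discrete_gradient_quadratic {n : ℕ}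
    (A : Matrix (Fin n) (Fin n) ℝ) (hA : A = Aᵀ) (b : Fin n → ℝ)
    (f : (Fin n → ℝ) → ℝ)
    (hf : ∀ z, f z = (1 / 2) * (z ⬝ᵥ A.mulVec z) - z ⬝ᵥ b)
    (x y : Fin n → ℝ) (hxy : ∀ i, x i ≠ y i) :
    ∀ i : Fin n,
      (f (fun j => if j ≤ i then x j else y j)
          - f (fun j => if j < i then x j else y j)) / (x i - y i)
        = (∑ j ∈ Finset.univ.filter (fun j => j < i), A i j * x j)
            + A i i * (x i + y i) / 2
            + (∑ j ∈ Finset.univ.filter (fun j => i < j), A i j * y j)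
            - b i := by
  intro i
  set w : Fin n → ℝ := fun j => if j < i then x j else y j with hw
  have hstep : (fun j => if j ≤ i then x j else y j) = w + Pi.single i (x i - y i) := by
    ext j
    rcases lt_trichotomy j i with h | rfl | h
    · simp [hw, h, h.le, h.ne]
    · simp [hw]
    · simp [hw, h.not_ge, h.not_gt, h.ne']
  have hrow : A.mulVec w i = (∑ j ∈ univ.filter (fun j => j < i), A i j * x j) + A i i * y i
      + ∑ j ∈ univ.filter (fun j => i < j), A i j * y j := by
    rw [mulVec, dotProduct, sum_eq_sum_lt_add_add_sum_gt _ i]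
    congr 1
    · congr 1
      · refine sum_congr rfl fun j hj => ?_
        simp [hw, (mem_filter.mp hj).2]
      · simp [hw]
    · refine sum_congr rfl fun j hj => ?_
      simp [hw, (mem_filter.mp hj).2.not_gt]
  rw [hstep, hf, hf, quadratic_energy_add_single_sub hA.symm,
    mul_div_cancel_left₀ _ (sub_ne_zero.mpr (hxy i)), hrow]
  ring
end

section
/- Let A be a symmetric positive definite real n×n matrix with decomposition A = D + L + U into its diagonal, strictly lower triangular, and strictly upper triangular parts, let b ∈ ℝⁿ, and let h > 0. Define the sequence x⁽⁰⁾ = x₀ and x⁽ᵏ⁺¹⁾ = G x⁽ᵏ⁾ + c with G = ((1 + h/2)·D + h·L)⁻¹ * ((1 − h/2)·D − h·U) and c = h · ((1 + h/2)·D + h·L)⁻¹ *ᵥ b. Then for every initial vector x₀ ∈ ℝⁿ, the sequence x⁽ᵏ⁾ converges to A⁻¹ *ᵥ b as k → ∞. -/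
open Matrix Filter

namespace Matrix

variable {ι : Type*} [Fintype ι] [DecidableEq ι]

/-- A real square matrix with positive definite symmetric part is invertible. -/
lemma isUnit_of_posDef_add_transpose {M : Matrix ι ι ℝ} (hM : (M + Mᵀ).PosDef) : IsUnit M := by
  rw [← mulVec_injective_iff_isUnit, ← coe_mulVecLin, injective_iff_map_eq_zero]
  intro v hv
  rw [mulVecLin_apply] at hv
  by_contra hne
  have hpos := hM.dotProduct_mulVec_pos hne
  rw [star_trivial, add_mulVec, dotProduct_add, dotProduct_transpose_mulVec, hv] at hpos
  simp at hpos

/-- If `M` splits the positive definite matrix `A` with `M + Mᵀ - A` diagonal and positive,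
then the squared energy norm of the error decreases by the value of this diagonal form on the
increment. -/
lemma dotProduct_mulVec_sub_eq_of_add_transpose_eq {A M : Matrix ι ι ℝ} {d : ι → ℝ}
    (hA : Aᵀ = A) (hM : M + Mᵀ = A + diagonal d) {u v : ι → ℝ}
    (huv : M *ᵥ (u - v) = A *ᵥ u) :
    u ⬝ᵥ A *ᵥ u - v ⬝ᵥ A *ᵥ v = ∑ i, d i * (u i - v i) ^ 2 := by
  obtain ⟨w, rfl⟩ : ∃ w, v = u - w := ⟨u - v, by simp⟩
  have hw : M *ᵥ w = A *ᵥ u := by simpa using huv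
  have hsymm : u ⬝ᵥ A *ᵥ w = w ⬝ᵥ A *ᵥ u := by
    conv_lhs => rw [← hA]
    exact dotProduct_transpose_mulVec ..
  have hform := congrArg (fun B => w ⬝ᵥ B *ᵥ w) hM
  simp only [add_mulVec, dotProduct_add, dotProduct_transpose_mulVec, hw] at hform
  have hdiag : w ⬝ᵥ diagonal d *ᵥ w = ∑ i, d i * (u i - (u - w) i) ^ 2 := by
    simp only [dotProduct, mulVec_diagonal, Pi.sub_apply]
    exact Finset.sum_congr rfl fun i _ => by ring
  rw [← hdiag, mulVec_sub, sub_dotProduct, dotProduct_sub, dotProduct_sub, hsymm]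
  linarith

/-- The error of a stationary iteration whose splitting matrix `M` satisfies
`M + Mᵀ = A + diagonal d` with `A` positive definite and `d` positive tends to zero. -/
lemma PosDef.tendsto_zero_of_add_transpose_eq {A M : Matrix ι ι ℝ} {d : ι → ℝ}
    (hA : A.PosDef) (hd : ∀ i, 0 < d i) (hM : M + Mᵀ = A + diagonal d) {e : ℕ → ι → ℝ}
    (he : ∀ k, M *ᵥ (e k - e (k + 1)) = A *ᵥ e k) :
    Tendsto e atTop (nhds 0) := by
  have hAt : Aᵀ = A := by simpa [IsHermitian] using hA.isHermitian
  set V : ℕ → ℝ := fun k => e k ⬝ᵥ A *ᵥ e k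
  have hV (k) : V k - V (k + 1) = ∑ i, d i * (e k i - e (k + 1) i) ^ 2 :=
    dotProduct_mulVec_sub_eq_of_add_transpose_eq hAt hM (he k)
  have hterm (k i) : 0 ≤ d i * (e k i - e (k + 1) i) ^ 2 :=
    mul_nonneg (hd i).le (sq_nonneg _)
  have hanti : Antitone V := antitone_nat_of_succ_le fun k =>
    sub_nonneg.1 ((hV k).symm ▸ Finset.sum_nonneg fun i _ => hterm k i)
  have hbdd : BddBelow (Set.range V) := by
    refine ⟨0, ?_⟩
    rintro _ ⟨k, rfl⟩
    simpa using hA.posSemidef.dotProduct_mulVec_nonneg (e k)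
  have hlim := tendsto_atTop_ciInf hanti hbdd
  have hdecr : Tendsto (fun k => V k - V (k + 1)) atTop (nhds 0) := by
    simpa using hlim.sub (hlim.comp (tendsto_add_atTop_nat 1))
  have hincr : Tendsto (fun k => e k - e (k + 1)) atTop (nhds 0) := by
    refine tendsto_pi_nhds.2 fun i => ?_
    have hsq : Tendsto (fun k => d i * (e k i - e (k + 1) i) ^ 2) atTop (nhds 0) :=
      squeeze_zero (fun k => hterm k i) (fun k => (hV k).symm ▸
        Finset.single_le_sum (fun j _ => hterm k j) (Finset.mem_univ i)) hdecr
    have hsqrt := (hsq.const_mul (d i)⁻¹).sqrt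
    simp only [inv_mul_cancel_left₀ (hd i).ne', Real.sqrt_sq_eq_abs, mul_zero,
      Real.sqrt_zero] at hsqrt
    exact (tendsto_zero_iff_abs_tendsto_zero _).2 hsqrt
  have hrec (k) : e k = A⁻¹ *ᵥ M *ᵥ (e k - e (k + 1)) := by
    rw [he, mulVec_mulVec, nonsing_inv_mul _ ((isUnit_iff_isUnit_det A).1 hA.isUnit), one_mulVec]
  have hcont : Continuous fun v : ι → ℝ => A⁻¹ *ᵥ M *ᵥ v := by fun_prop
  have hmap := (hcont.tendsto 0).comp hincr
  simp only [mulVec_zero] at hmap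
  exact hmap.congr fun k => (hrec k).symm

end Matrix

/-- Unconditional convergence of the Itoh–Abe discrete gradient scheme (the SOR
method with `h = 2ω/(2-ω)`): for a symmetric positive definite `A = D + L + U`
and any stepsize `h > 0`, the iteration `x⁽ᵏ⁺¹⁾ = G x⁽ᵏ⁾ + c` with
`G = ((1+h/2)D + hL)⁻¹((1-h/2)D - hU)` and `c = h((1+h/2)D + hL)⁻¹ b` converges
to `A⁻¹ b` for every initial vector `x₀`. -/
theorem discrete_gradient_scheme_converges {n : ℕ}
    (A : Matrix (Fin n) (Fin n) ℝ) (hA : A.PosDef) (hAsymm : A = Aᵀ)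
    (D L U : Matrix (Fin n) (Fin n) ℝ)
    (hD : D = Matrix.diagonal fun i => A i i)
    (hL : L = Matrix.of fun i j => if j < i then A i j else 0)
    (hU : U = Matrix.of fun i j => if i < j then A i j else 0)
    (b : Fin n → ℝ) (h : ℝ) (hh : 0 < h) (x₀ : Fin n → ℝ)
    (x : ℕ → Fin n → ℝ) (hx0 : x 0 = x₀)
    (hxk : ∀ k : ℕ, x (k + 1)
      = (((1 + h / 2) • D + h • L)⁻¹ * ((1 - h / 2) • D - h • U)).mulVec (x k)
        + h • (((1 + h / 2) • D + h • L)⁻¹).mulVec b) :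
    Tendsto x atTop (nhds (A⁻¹.mulVec b)) := by
  have hAdet : IsUnit A.det := (isUnit_iff_isUnit_det A).1 hA.isUnit
  have hsplit : D + L + U = A := by
    subst hD hL hU
    ext i j
    rcases lt_trichotomy i j with hij | rfl | hij
    · simp [hij, hij.ne, hij.not_gt]
    · simp
    · simp [hij, hij.ne', hij.not_gt]
  have hDt : Dᵀ = D := by rw [hD, diagonal_transpose]
  have hLt : Lᵀ = U := by
    subst hL hU
    ext i j
    have hij : A j i = A i j := congrFun₂ hAsymm.symm i j
    simp [hij]
  set M := (1 + h / 2) • D + h • L with hMdef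
  set N := (1 - h / 2) • D - h • U
  have hMN : M - N = h • A := by
    rw [← hsplit]
    module
  have hsum : h⁻¹ • M + (h⁻¹ • M)ᵀ = A + diagonal fun i => 2 / h * A i i := by
    have hdiag : (diagonal fun i => 2 / h * A i i) = (2 / h) • D := by
      rw [hD, ← diagonal_smul]
      rfl
    rw [hdiag, hMdef, ← hsplit]
    simp only [transpose_smul, transpose_add, hDt, hLt]
    match_scalars <;> field_simp <;> ring
  have hdpos (i) : 0 < 2 / h * A i i := mul_pos (by positivity) hA.diag_pos
  have hMunit : IsUnit (h⁻¹ • M) :=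
    isUnit_of_posDef_add_transpose (hsum ▸ hA.add (.diagonal hdpos))
  have hMdet : IsUnit M.det := by
    rw [← isUnit_iff_isUnit_det]
    simpa [smul_smul, hh.ne'] using hMunit.smul (Units.mk0 h hh.ne')
  have hstep (k) : M *ᵥ x (k + 1) = N *ᵥ x k + h • b := by
    rw [hxk, mulVec_add, mulVec_smul, mulVec_mulVec, mulVec_mulVec,
      mul_nonsing_inv_cancel_left _ _ hMdet, mul_nonsing_inv _ hMdet, one_mulVec]
  have herr : Tendsto (fun k => x k - A⁻¹ *ᵥ b) atTop (nhds 0) := by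
    refine hA.tendsto_zero_of_add_transpose_eq hdpos hsum fun k => ?_
    have hNx : N *ᵥ x k = M *ᵥ x k - h • A *ᵥ x k := by
      rw [← smul_mulVec, ← hMN, sub_mulVec M N, sub_sub_cancel]
    rw [sub_sub_sub_cancel_right, smul_mulVec, mulVec_sub, hstep, hNx, mulVec_sub,
      mulVec_mulVec, mul_nonsing_inv _ hAdet, one_mulVec]
    match_scalars <;> field_simp <;> ring
  simpa using herr.add_const (A⁻¹ *ᵥ b)
end

section
/- Let A be a symmetric positive definite real n×n matrix with decomposition A = D + L + U into its diagonal, strictly lower triangular, and strictly upper triangular parts. Let ω ∈ (0,2) and h = 2ω/(2−ω). Then the matrices (1 + h/2)·D + h·U and D + ω·U are invertible and ((1 + h/2)·D + h·U)⁻¹ * ((1 − h/2)·D − h·L) = (D + ω·U)⁻¹ * ((1 − ω)·D − ω·L), and for every b ∈ ℝⁿ, h·((1 + h/2)·D + h·U)⁻¹ *ᵥ b = ω·(D + ω·U)⁻¹ *ᵥ b. (This is the backward half-step identity; combined with the forward identity it shows that alternating the Itoh–Abe scheme and its reversed variant is equivalent to the symmetric SOR method.) -/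
open Matrix

/-- The matrix `D + ω U`, with `D` the diagonal and `U` the strictly upper triangular part of `A`,
is invertible when the diagonal of `A` has no zeros. -/
theorem isUnit_diagonal_add_smul_strictUpper {n : ℕ} (A : Matrix (Fin n) (Fin n) ℝ)
    (hA : ∀ i, A i i ≠ 0) (ω : ℝ) :
    IsUnit ((Matrix.diagonal fun i => A i i) +
      ω • Matrix.of fun i j => if i < j then A i j else 0) := by
  rw [Matrix.isUnit_iff_isUnit_det, Matrix.det_of_isUpperTriangular]
  · simpa [Finset.prod_eq_zero_iff] using hA
  · intro i j hij
    have hji : j < i := hij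
    simp [hji.ne', hji.not_gt]

/-- Backward half-step identity: for a symmetric positive definite matrix
`A = D + L + U` and `ω ∈ (0,2)`, with `h = 2ω/(2-ω)`, the matrices
`(1+h/2)D + hU` and `D + ωU` are invertible, the backward iteration matrices of
the reversed Itoh–Abe discrete gradient scheme and of the backward SOR sweep
coincide, and so do the iteration vectors for every `b`. -/
theorem backward_sor_discrete_gradient_equivalence {n : ℕ}
    (A : Matrix (Fin n) (Fin n) ℝ) (hA : A.PosDef) (hAsymm : A = Aᵀ)
    (D L U : Matrix (Fin n) (Fin n) ℝ)
    (hD : D = Matrix.diagonal fun i => A i i)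
    (hL : L = Matrix.of fun i j => if j < i then A i j else 0)
    (hU : U = Matrix.of fun i j => if i < j then A i j else 0)
    (ω : ℝ) (hω : ω ∈ Set.Ioo (0 : ℝ) 2)
    (h : ℝ) (hh : h = 2 * ω / (2 - ω)) :
    IsUnit ((1 + h / 2) • D + h • U) ∧ IsUnit (D + ω • U) ∧
    ((1 + h / 2) • D + h • U)⁻¹ * ((1 - h / 2) • D - h • L)
      = (D + ω • U)⁻¹ * ((1 - ω) • D - ω • L) ∧
    ∀ b : Fin n → ℝ,
      h • (((1 + h / 2) • D + h • U)⁻¹).mulVec b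
        = ω • ((D + ω • U)⁻¹).mulVec b := by
  have hunit : IsUnit (D + ω • U) := by
    rw [hD, hU]
    exact isUnit_diagonal_add_smul_strictUpper A (fun i => hA.diag_pos.ne') ω
  have hω2 : 2 - ω ≠ 0 := by linarith [hω.2]
  obtain ⟨c, hc⟩ : ∃ c : ℝˣ, (c : ℝ) = 2 / (2 - ω) :=
    ⟨Units.mk0 _ (div_ne_zero two_ne_zero hω2), rfl⟩
  have hcω : h = c * ω := by rw [hh, hc]; ring
  have hplus : 1 + h / 2 = c := by rw [hh, hc]; field_simp; ring
  have hminus : 1 - h / 2 = c * (1 - ω) := by rw [hh, hc]; field_simp; ring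
  have hleft : (1 + h / 2) • D + h • U = c • (D + ω • U) := by
    rw [hplus, hcω, Units.smul_def, smul_add, smul_smul]
  have hright : (1 - h / 2) • D - h • L = c • ((1 - ω) • D - ω • L) := by
    rw [hminus, hcω, Units.smul_def, smul_sub, smul_smul, smul_smul]
  have hinv : (c • (D + ω • U))⁻¹ = c⁻¹ • (D + ω • U)⁻¹ :=
    Matrix.inv_smul' _ c ((Matrix.isUnit_iff_isUnit_det _).mp hunit)
  rw [hleft, hright, hinv]
  refine ⟨hunit.smul c, hunit, ?_, fun b => ?_⟩
  · rw [smul_mul_smul_comm, inv_mul_cancel, one_smul]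
  · rw [hcω, Units.smul_def, Matrix.smul_mulVec, smul_smul, mul_right_comm, Units.mul_inv, one_mul]
end
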